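/- arXiv:2012.03979 — 2 statements merged into one kernel-verified Lean document; each statement's English description precedes it below -/
import Mathlib

section
/- Let m ≥ 1 and T be positive integers, and let a_1, ..., a_{3m} be positive integers with T/4 < a_j < T/2 for all j and Σ_{j=1}^{3m} a_j = mT. Consider the instance with agents 1, ..., m+1 and items o_1, ..., o_{3m}, g_1, g_2, where for each agent i ≤ m: u_i(o_j) = a_j and u_i(g_1) = u_i(g_2) = T, and for agent m+1: u_{m+1}(o_j) = 0 and u_{m+1}(g_1) = u_{m+1}(g_2) = (m/2 + 1)·T. Then there exists an allocation that is both utilitarian-maximal and EFx if and only if the index set {1, ..., 3m} can be partitioned into m pairwise disjoint triples such that Σ_{j ∈ triple} a_j = T for each triple. -/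
open Finset

/-- An allocation: bundles are pairwise disjoint and every item is allocated. -/
def IsAllocation {A I : Type*} (p : A → Finset I) : Prop :=
  (∀ i j : A, i ≠ j → Disjoint (p i) (p j)) ∧ ∀ o : I, ∃ i : A, o ∈ p i

/-- Utilitarian welfare of an allocation. -/
def welfare {A I : Type*} [Fintype A] (u : A → I → ℚ) (p : A → Finset I) : ℚ :=
  ∑ i : A, ∑ o ∈ p i, u i o

/-- Utilitarian-maximal allocation: an allocation whose welfare is maximal among allocations. -/
def IsUM {A I : Type*} [Fintype A] (u : A → I → ℚ) (p : A → Finset I) : Prop :=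
  IsAllocation p ∧ ∀ q : A → Finset I, IsAllocation q → welfare u q ≤ welfare u p

/-- Envy-freeness up to one item. -/
def EF1 {A I : Type*} [DecidableEq I] (u : A → I → ℚ) (p : A → Finset I) : Prop :=
  ∀ i j : A, ∃ O' ⊆ p j, O'.card ≤ 1 ∧ ∑ o ∈ p i, u i o ≥ ∑ o ∈ p j \ O', u i o

/-- Envy-freeness up to any item. -/
def EFx {A I : Type*} [DecidableEq I] (u : A → I → ℚ) (p : A → Finset I) : Prop :=
  ∀ i j : A, ∀ o ∈ p j, ∑ o' ∈ p i, u i o' ≥ ∑ o' ∈ (p j).erase o, u i o'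

/-- Proportionality up to one item. -/
def PROP1 {A I : Type*} [Fintype A] [Fintype I] [DecidableEq I]
    (u : A → I → ℚ) (p : A → Finset I) : Prop :=
  ∀ i : A, ∃ O' ⊆ Finset.univ \ p i, O'.card ≤ 1 ∧
    ∑ o ∈ p i ∪ O', u i o ≥ (∑ o : I, u i o) / (Fintype.card A : ℚ)

/-- Proportionality up to any item. -/
def PROPx {A I : Type*} [Fintype A] [Fintype I] [DecidableEq I]
    (u : A → I → ℚ) (p : A → Finset I) : Prop :=
  ∀ i : A, ∀ o ∈ Finset.univ \ p i,
    ∑ o' ∈ insert o (p i), u i o' ≥ (∑ o' : I, u i o') / (Fintype.card A : ℚ)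

/-- An allocation amounts to a function sending each item to the agent who receives it. -/
theorem IsAllocation.exists_owner {A I : Type*} {p : A → Finset I} (hp : IsAllocation p) :
    ∃ w : I → A, ∀ i o, o ∈ p i ↔ w o = i := by
  choose w hw using hp.2
  refine ⟨w, fun i o => ⟨fun h => ?_, fun h => h ▸ hw o⟩⟩
  by_contra hne
  exact Finset.disjoint_left.mp (hp.1 _ _ hne) (hw o) h

theorem isAllocation_of_owner {A I : Type*} {p : A → Finset I} {w : I → A}
    (hw : ∀ i o, o ∈ p i ↔ w o = i) : IsAllocation p := by
  refine ⟨fun i j hij => Finset.disjoint_left.mpr fun o hi hj => hij ?_, fun o => ⟨w o, ?_⟩⟩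
  · rw [← (hw i o).mp hi, (hw j o).mp hj]
  · exact (hw _ _).mpr rfl

theorem welfare_eq_sum_owner {A I : Type*} [Fintype A] [Fintype I] (u : A → I → ℚ)
    {p : A → Finset I} {w : I → A} (hw : ∀ i o, o ∈ p i ↔ w o = i) :
    welfare u p = ∑ o, u (w o) o := by
  classical
  rw [welfare, ← Finset.sum_fiberwise Finset.univ w]
  refine Finset.sum_congr rfl fun i _ => ?_
  have hpi : p i = Finset.univ.filter fun o => w o = i := by ext o; simp [hw]
  rw [hpi]
  exact Finset.sum_congr rfl fun o ho => by rw [(Finset.mem_filter.mp ho).2]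

/-- An allocation is utilitarian-maximal iff each item goes to an agent valuing it the most. -/
theorem isUM_iff_of_owner {A I : Type*} [Fintype A] [Fintype I] (u : A → I → ℚ)
    {p : A → Finset I} {w : I → A} (hw : ∀ i o, o ∈ p i ↔ w o = i) :
    IsUM u p ↔ ∀ i o, u i o ≤ u (w o) o := by
  classical
  constructor
  · intro h i o
    have hq : ∀ k o', o' ∈ Finset.univ.filter (fun x => Function.update w o i x = k) ↔
        Function.update w o i o' = k := by simp
    have hle := h.2 _ (isAllocation_of_owner hq)
    rw [welfare_eq_sum_owner u hq, welfare_eq_sum_owner u hw,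
      ← Finset.add_sum_erase _ _ (Finset.mem_univ o),
      ← Finset.add_sum_erase _ (fun o => u (w o) o) (Finset.mem_univ o),
      Finset.sum_congr rfl (g := fun o => u (w o) o) fun x hx => by
        rw [Function.update_of_ne (Finset.ne_of_mem_erase hx)]] at hle
    simpa only [Function.update_self, add_le_add_iff_right] using hle
  · refine fun h => ⟨isAllocation_of_owner hw, fun q hq => ?_⟩
    obtain ⟨v, hv⟩ := hq.exists_owner
    rw [welfare_eq_sum_owner u hv, welfare_eq_sum_owner u hw]
    exact Finset.sum_le_sum fun o _ => h _ _

/-- The value of a bundle of items of two kinds, split by kind. -/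
theorem sum_bundle_sum_type {A I J : Type*} [Fintype I] [Fintype J] [DecidableEq A]
    {p : A → Finset (I ⊕ J)} {w : I ⊕ J → A} (hw : ∀ i o, o ∈ p i ↔ w o = i)
    (v : I ⊕ J → ℚ) (i : A) :
    ∑ o ∈ p i, v o = ∑ x with w (Sum.inl x) = i, v (Sum.inl x) +
      ∑ y with w (Sum.inr y) = i, v (Sum.inr y) := by
  have hpi : p i = Finset.univ.filter fun o => w o = i := by ext o; simp [hw]
  simp only [hpi, Finset.sum_filter, Fintype.sum_sum_type]

theorem card_eq_three_of_sum_eq {ι : Type*} {a : ι → ℕ} {T : ℕ} (hT : 0 < T)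
    (ha : ∀ j, T < 4 * a j ∧ 2 * a j < T) {S : Finset ι} (hS : ∑ j ∈ S, a j = T) :
    S.card = 3 := by
  have hne : S.Nonempty := by
    rw [Finset.nonempty_iff_ne_empty]
    rintro rfl
    simp at hS
    lia
  have h1 : S.card * T < 4 * T := by
    conv_rhs => rw [← hS]
    rw [Finset.mul_sum, ← smul_eq_mul, ← Finset.sum_const]
    exact Finset.sum_lt_sum_of_nonempty hne fun j _ => (ha j).1
  have h2 : 2 * T < S.card * T := by
    conv_lhs => rw [← hS]
    rw [Finset.mul_sum, ← smul_eq_mul, ← Finset.sum_const]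
    exact Finset.sum_lt_sum_of_nonempty hne fun j _ => (ha j).2
  have := Nat.lt_of_mul_lt_mul_right h1
  have := Nat.lt_of_mul_lt_mul_right h2
  lia

/-- For the 3-Partition reduction instance, a UM and EFx allocation
exists iff the integers can be partitioned into m triples each summing to T. -/
theorem exists_um_efx_iff_three_partition
    (m T : ℕ) (hm : 1 ≤ m) (hT : 0 < T)
    (a : Fin (3 * m) → ℕ) (ha0 : ∀ j, 0 < a j)
    (ha : ∀ j, T < 4 * a j ∧ 2 * a j < T)
    (hsum : ∑ j, a j = m * T)
    (u : Fin (m + 1) → (Fin (3 * m) ⊕ Fin 2) → ℚ)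
    (hu1 : ∀ i : Fin (m + 1), (i : ℕ) < m → ∀ j, u i (Sum.inl j) = a j)
    (hu2 : ∀ i : Fin (m + 1), (i : ℕ) < m → ∀ k, u i (Sum.inr k) = T)
    (hu3 : ∀ j, u (Fin.last m) (Sum.inl j) = 0)
    (hu4 : ∀ k, u (Fin.last m) (Sum.inr k) = ((m : ℚ) / 2 + 1) * T) :
    (∃ p : Fin (m + 1) → Finset (Fin (3 * m) ⊕ Fin 2), IsUM u p ∧ EFx u p) ↔
    (∃ f : Fin (3 * m) → Fin m, ∀ k : Fin m,
      (Finset.univ.filter fun j => f j = k).card = 3 ∧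
      ∑ j ∈ Finset.univ.filter (fun j => f j = k), a j = T) := by
  have hTq : (0 : ℚ) < T := by exact_mod_cast hT
  have hmq : (1 : ℚ) ≤ m := by exact_mod_cast hm
  have hbig : (T : ℚ) < ((m : ℚ) / 2 + 1) * T := by nlinarith
  have hne (k : Fin m) : k.castSucc ≠ Fin.last m := k.castSucc_ne_last
  replace hu1 (k : Fin m) j : u k.castSucc (Sum.inl j) = a j := hu1 _ k.isLt j
  replace hu2 (k : Fin m) l : u k.castSucc (Sum.inr l) = T := hu2 _ k.isLt l
  constructor
  · rintro ⟨p, hUM, hEFx⟩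
    obtain ⟨w, hw⟩ := hUM.1.exists_owner
    rw [isUM_iff_of_owner u hw] at hUM
    have hl (j) : ∃ k : Fin m, k.castSucc = w (Sum.inl j) := by
      refine Fin.exists_castSucc_eq.mpr fun h => ?_
      have hle := hUM (Fin.castSucc ⟨0, hm⟩) (Sum.inl j)
      rw [h, hu3, hu1] at hle
      have : (0 : ℚ) < a j := by exact_mod_cast ha0 j
      linarith
    have hr (l) : w (Sum.inr l) = Fin.last m := by
      by_contra h
      obtain ⟨k, hk⟩ := Fin.exists_castSucc_eq.mpr h
      have hle := hUM (Fin.last m) (Sum.inr l)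
      rw [← hk, hu4, hu2] at hle
      linarith
    choose f hf using hl
    have hge (k : Fin m) : T ≤ ∑ j with f j = k, a j := by
      have h0 : Sum.inr 0 ∈ p (Fin.last m) := (hw _ _).mpr (hr 0)
      have h := hEFx k.castSucc (Fin.last m) _ h0
      rw [Finset.sum_erase_eq_sub h0, sum_bundle_sum_type hw, sum_bundle_sum_type hw] at h
      simp only [hu1, hu2, ← hf, hr, hne, (hne _).symm, Fin.castSucc_inj, Finset.filter_true,
        Finset.filter_false, Finset.sum_empty, Finset.sum_const, Finset.card_univ,
        Fintype.card_fin, nsmul_eq_mul] at h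
      rw [Finset.card_empty] at h
      push_cast at h
      have : (T : ℚ) ≤ ∑ j with f j = k, (a j : ℚ) := by linarith
      exact_mod_cast this
    have hall : ∑ _k : Fin m, T = ∑ k, ∑ j with f j = k, a j := by
      rw [Finset.sum_fiberwise, hsum]
      simp
    have heq := (Finset.sum_eq_sum_iff_of_le fun k _ => hge k).mp hall
    refine ⟨f, fun k => ?_⟩
    have hk := (heq k (Finset.mem_univ k)).symm
    exact ⟨card_eq_three_of_sum_eq hT ha hk, hk⟩
  · rintro ⟨f, hf⟩
    let w : Fin (3 * m) ⊕ Fin 2 → Fin (m + 1) :=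
      Sum.elim (fun j => (f j).castSucc) fun _ => Fin.last m
    let p (i : Fin (m + 1)) := Finset.univ.filter fun o => w o = i
    have hw : ∀ i o, o ∈ p i ↔ w o = i := by simp [p]
    have hnonneg i o : 0 ≤ u i o := by
      induction i using Fin.lastCases <;> rcases o with j | l <;>
        simp only [hu1, hu2, hu3, hu4] <;> positivity
    have hown (k k' : Fin m) : ∑ o ∈ p k'.castSucc, u k.castSucc o = T := by
      rw [sum_bundle_sum_type hw]
      simp only [w, Sum.elim_inl, Sum.elim_inr, (hne _).symm, Fin.castSucc_inj, hu1,
        Finset.filter_false, Finset.sum_empty, add_zero]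
      exact_mod_cast (hf k').2
    have herase i j o : ∑ o' ∈ (p j).erase o, u i o' ≤ ∑ o' ∈ p j, u i o' :=
      Finset.sum_le_sum_of_subset_of_nonneg (Finset.erase_subset _ _) fun _ _ _ => hnonneg _ _
    refine ⟨p, (isUM_iff_of_owner u hw).mpr fun i o => ?_, fun i j o ho => ?_⟩
    · induction i using Fin.lastCases <;> rcases o with j | l <;>
        simp [w, hu1, hu2, hu3, hu4, hbig.le]
    · induction i using Fin.lastCases with
      | last =>
        induction j using Fin.lastCases with
        | last => exact herase _ _ _
        | cast k =>
          have hz : ∑ o ∈ p k.castSucc, u (Fin.last m) o = 0 := by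
            rw [sum_bundle_sum_type hw]
            simp [w, hu3, (hne _).symm]
          exact (herase _ _ _).trans (hz.trans_le (Finset.sum_nonneg fun _ _ => hnonneg _ _))
      | cast k =>
        induction j using Fin.lastCases with
        | last =>
          rw [hown, Finset.sum_erase_eq_sub ho, sum_bundle_sum_type hw]
          rcases o with j | l
          · exact absurd ((hw _ _).mp ho) (hne _)
          · simp only [w, Sum.elim_inl, Sum.elim_inr, hne, hu2, Finset.filter_true,
              Finset.filter_false, Finset.sum_empty, Finset.sum_const, Finset.card_univ,
              Fintype.card_fin, nsmul_eq_mul]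
            push_cast
            linarith
        | cast k' =>
          rw [hown]
          exact (herase _ _ _).trans (hown _ _).le
end

section
/- Let m ≥ 1 and let v_1, ..., v_m and w_1, ..., w_m be positive integers; set W = Σ w_i, V = Σ v_i, w* = max_i w_i, and let T be an integer with 2T ≥ W. Consider the instance with two agents A (Alice) and B (Bob) and items o_1, ..., o_m, o_A, o_B, where: u_A(o_i) = w_i and u_B(o_i) = w_i + v_i for all i; u_A(o_A) = 2T − W + w*, u_B(o_A) = 2T + V + w*; u_A(o_B) = w*, u_B(o_B) = W + V + w*. Then the maximum utilitarian welfare among all PROP1 allocations equals 2W + 2V + 2T + 2w* + max{ Σ_{i∈S} v_i : S ⊆ {1, ..., m}, Σ_{i∈S} w_i ≤ T }. -/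
open Finset

/-- With two agents, the second bundle of an allocation is the complement of the first. -/
theorem IsAllocation.apply_one_eq_compl {I : Type*} [Fintype I] [DecidableEq I]
    {p : Fin 2 → Finset I} (hp : IsAllocation p) : p 1 = (p 0)ᶜ := by
  ext o
  rw [mem_compl]
  refine ⟨fun h h' => disjoint_left.1 (hp.1 0 1 (by decide)) h' h, fun h => ?_⟩
  obtain ⟨i, hi⟩ := hp.2 o
  fin_cases i
  · exact absurd hi h
  · exact hi

/-- With two agents, the welfare of an allocation is the value of all items to the second agent
minus the loss on the items given to the first. -/
theorem IsAllocation.welfare_eq {I : Type*} [Fintype I] [DecidableEq I] (u : Fin 2 → I → ℚ)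
    {p : Fin 2 → Finset I} (hp : IsAllocation p) :
    welfare u p = ∑ o, u 1 o - ∑ o ∈ p 0, (u 1 o - u 0 o) := by
  rw [welfare, Fin.sum_univ_two, hp.apply_one_eq_compl, sum_sub_distrib,
    ← sum_add_sum_compl (p 0) (u 1)]
  ring

/-- Complementary bundles form an allocation between two agents. -/
theorem isAllocation_compl {I : Type*} [Fintype I] [DecidableEq I] (X : Finset I) :
    IsAllocation ![X, Xᶜ] := by
  constructor
  · intro i j hij
    fin_cases i <;> fin_cases j <;>
      simp_all [disjoint_compl_right, disjoint_compl_left]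
  · intro o
    by_cases h : o ∈ X
    · exact ⟨0, h⟩
    · exact ⟨1, by simpa using h⟩


/-- In the Knapsack reduction instance (case 2T ≥ W), the maximum
utilitarian welfare among PROP1 allocations equals
2W + 2V + 2T + 2w* + max{ Σ_{i∈S} v_i : Σ_{i∈S} w_i ≤ T }. -/
theorem max_welfare_within_prop1_eq_knapsack
    (m : ℕ) (hm : 1 ≤ m)
    (v w : Fin m → ℕ) (hv : ∀ i, 0 < v i) (hw : ∀ i, 0 < w i)
    (W V wstar : ℕ) (hW : W = ∑ i, w i) (hV : V = ∑ i, v i)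
    (hws : wstar = Finset.univ.sup w)
    (T : ℤ) (hT : (W : ℤ) ≤ 2 * T)
    (u : Fin 2 → (Fin m ⊕ Fin 2) → ℚ)
    (huAo : ∀ i, u 0 (Sum.inl i) = w i)
    (huBo : ∀ i, u 1 (Sum.inl i) = w i + v i)
    (huAA : u 0 (Sum.inr 0) = 2 * (T : ℚ) - W + wstar)
    (huBA : u 1 (Sum.inr 0) = 2 * (T : ℚ) + V + wstar)
    (huAB : u 0 (Sum.inr 1) = (wstar : ℚ))
    (huBB : u 1 (Sum.inr 1) = (W : ℚ) + V + wstar) :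
    ∃ K : ℚ,
      IsGreatest {x : ℚ | ∃ S : Finset (Fin m),
        (∑ i ∈ S, (w i : ℤ)) ≤ T ∧ x = ∑ i ∈ S, (v i : ℚ)} K ∧
      IsGreatest {x : ℚ | ∃ p : Fin 2 → Finset (Fin m ⊕ Fin 2),
        IsAllocation p ∧ PROP1 u p ∧ welfare u p = x}
        (2 * (W : ℚ) + 2 * V + 2 * T + 2 * wstar + K) := by
  have hT0 : (0 : ℤ) ≤ T := by have := Int.natCast_nonneg W; omega
  have hTq : (0 : ℚ) ≤ T := by exact_mod_cast hT0
  have hTq' : (W : ℚ) ≤ 2 * T := by exact_mod_cast hT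
  have hWq : ∑ i, (w i : ℚ) = W := by rw [hW]; push_cast; rfl
  have hVq : ∑ i, (v i : ℚ) = V := by rw [hV]; push_cast; rfl
  have hW0 : (0 : ℚ) ≤ W := W.cast_nonneg
  have hV0 : (0 : ℚ) ≤ V := V.cast_nonneg
  have hws0 : (0 : ℚ) ≤ wstar := wstar.cast_nonneg
  have hwle : ∀ i, (w i : ℚ) ≤ wstar := fun i => by
    rw [hws]; exact_mod_cast le_sup (f := w) (mem_univ i)
  have hA : ∑ o, u 0 o = 2 * T + 2 * wstar := by
    simp only [Fintype.sum_sum_type, Fin.sum_univ_two, huAo, huAA, huAB, hWq]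
    ring
  have hB : ∑ o, u 1 o = 2 * W + 3 * V + 2 * T + 2 * wstar := by
    simp only [Fintype.sum_sum_type, Fin.sum_univ_two, huBo, huBA, huBB, sum_add_distrib,
      hWq, hVq]
    ring
  have hgap_inl : ∀ i, u 1 (Sum.inl i) - u 0 (Sum.inl i) = v i := fun i => by
    rw [huAo, huBo]; ring
  have hgap_inr : ∀ k, u 1 (Sum.inr k) - u 0 (Sum.inr k) = W + V := fun k => by
    fin_cases k
    · simp only [Fin.zero_eta, huBA, huAA]; ring
    · simp only [Fin.mk_one, huBB, huAB]; ring
  have hgap_nonneg : ∀ o, 0 ≤ u 1 o - u 0 o := by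
    rintro (i | k)
    · rw [hgap_inl]; positivity
    · rw [hgap_inr]; positivity
  have hA_le : ∀ o, u 0 o ≤ 2 * T - W + wstar := by
    rintro (i | k)
    · rw [huAo]; linarith [hwle i]
    · fin_cases k
      · exact huAA.le
      · exact huAB.le.trans (by linarith)
  have hsplit : ∀ S : Finset (Fin m), ∀ f : Fin m → ℚ,
      ∑ i ∈ Sᶜ, f i = ∑ i, f i - ∑ i ∈ S, f i := fun S f => by
    rw [← sum_add_sum_compl S f]; ring
  obtain ⟨S, hS, hmax⟩ := exists_max_image
    (univ.filter fun S : Finset (Fin m) => ∑ i ∈ S, (w i : ℤ) ≤ T) (fun S => ∑ i ∈ S, (v i : ℚ))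
    ⟨∅, by simpa using hT0⟩
  simp only [mem_filter, mem_univ, true_and] at hS hmax
  refine ⟨∑ i ∈ S, (v i : ℚ), ⟨⟨S, hS, rfl⟩, ?_⟩, ?_, ?_⟩
  · rintro x ⟨S', hS', rfl⟩
    exact hmax S' hS'
  · have hSq : ∑ i ∈ S, (w i : ℚ) ≤ T := by exact_mod_cast hS
    have halloc := isAllocation_compl (Sᶜ.disjSum (∅ : Finset (Fin 2)))
    refine ⟨_, halloc, ?_, ?_⟩
    · have hcompl : (Sᶜ.disjSum (∅ : Finset (Fin 2)))ᶜ = S.disjSum univ := by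
        ext (i | k) <;> simp
      rw [hcompl]
      intro i
      fin_cases i
      · refine ⟨{Sum.inr 0}, by simp, by simp, ?_⟩
        have hunion : Sᶜ.disjSum ∅ ∪ {Sum.inr 0} = Sᶜ.disjSum ({0} : Finset (Fin 2)) := by
          ext (i | k) <;> simp
        simp only [Fin.zero_eta, Matrix.cons_val_zero, hunion, sum_disjSum, sum_singleton, huAo,
          huAA, hA, hsplit, hWq, Fintype.card_fin]
        push_cast
        linarith
      · refine ⟨∅, by simp, by simp, ?_⟩
        have hSB : 0 ≤ ∑ i ∈ S, ((w i : ℚ) + v i) := by positivity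
        simp only [Fin.mk_one, Matrix.cons_val_one, Matrix.cons_val_fin_one, union_empty,
          sum_disjSum, Fin.sum_univ_two, huBo, huBA, huBB, hB, Fintype.card_fin]
        push_cast
        linarith
    · rw [halloc.welfare_eq, hB]
      simp only [Matrix.cons_val_zero, sum_disjSum, hgap_inl, sum_empty, hsplit, hVq]
      ring
  · rintro x ⟨p, hp, hprop, rfl⟩
    rw [hp.welfare_eq, hB]
    by_cases hk : ∃ k, Sum.inr k ∈ p 0
    · obtain ⟨k, hk⟩ := hk
      have hloss := single_le_sum (fun o _ => hgap_nonneg o) hk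
      rw [hgap_inr] at hloss
      have hK : (0 : ℚ) ≤ ∑ i ∈ S, (v i : ℚ) := by positivity
      linarith
    · have hp0 : p 0 = ((p 0).toLeftᶜ)ᶜ.disjSum ∅ := by
        ext (i | k)
        · simp
        · simpa using fun h => hk ⟨k, h⟩
      set R := (p 0).toLeftᶜ
      obtain ⟨O', hO', hcard, hge⟩ := hprop 0
      have hO'_le : ∑ o ∈ O', u 0 o ≤ 2 * T - W + wstar := by
        rcases card_le_one_iff_subset_singleton.1 hcard with ⟨o, ho⟩
        rcases subset_singleton_iff.1 ho with rfl | rfl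
        · rw [sum_empty]; linarith
        · rw [sum_singleton]; exact hA_le o
      have hdisj : Disjoint (p 0) O' := disjoint_sdiff.mono_right hO'
      rw [sum_union hdisj, hA, hp0, sum_disjSum, sum_empty] at hge
      simp only [huAo, hsplit, hWq, Fintype.card_fin] at hge
      push_cast at hge
      have hR : ∑ i ∈ R, (w i : ℚ) ≤ T := by linarith
      have hRmax := hmax R (by exact_mod_cast hR)
      rw [hp0, sum_disjSum, sum_empty]
      simp only [hgap_inl, hsplit, hVq]
      linarith
end
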